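/- Let θ₁, ..., θ_V ∈ ℝ^d be points whose affine span has dimension at least 2, and let L(z) = (1/V) Σ_v ‖z - θ_v‖₂. Then L is strictly convex on ℝ^d and attains a unique minimizer. -/

import Mathlib

/-- If `x - t` and `y - t` lie on a common ray and `x ≠ y`, then `t` lies on the line `x y`. -/
theorem mem_span_of_sameRay_aux {E : Type*} [NormedAddCommGroup E] [NormedSpace ℝ E]
    {x y t : E} (hxy : x ≠ y) {a b : ℝ} (ha : 0 < a) (hb : 0 < b)
    (h : SameRay ℝ (a • (x - t)) (b • (y - t))) :
    x - t ∈ Submodule.span ℝ {x - y} := by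
  replace h : SameRay ℝ (x - t) (y - t) := by
    have h' := (h.pos_smul_left (inv_pos.mpr ha)).pos_smul_right (inv_pos.mpr hb)
    rwa [inv_smul_smul₀ ha.ne', inv_smul_smul₀ hb.ne'] at h'
  obtain ⟨p, q, -, -, -, h1, h2⟩ := h.exists_eq_smul_add
  set s := (x - t) + (y - t) with hs
  have h3 : x - y = (p - q) • s := by
    rw [sub_smul, ← h1, ← h2]; abel
  have hpq : p - q ≠ 0 := by
    intro h0
    rw [h0, zero_smul, sub_eq_zero] at h3
    exact hxy h3
  rw [Submodule.mem_span_singleton]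
  refine ⟨p / (p - q), ?_⟩
  rw [h3, smul_smul, div_mul_cancel₀ _ hpq, ← h1]

/-- If the points `θ 1, ..., θ V` span an affine subspace of dimension at least 2, then
`L z = (1/V) ∑ v, ‖z - θ v‖₂` is strictly convex on `ℝ^d` and has a unique minimizer
(the geometric median). -/
theorem geometric_median_exists_unique (d V : ℕ) (θ : Fin V → EuclideanSpace ℝ (Fin d))
    (hdim : 2 ≤ Module.finrank ℝ
      (Submodule.span ℝ (Set.range fun p : Fin V × Fin V => θ p.1 - θ p.2))) :
    StrictConvexOn ℝ Set.univ
        (fun z : EuclideanSpace ℝ (Fin d) => (V : ℝ)⁻¹ * ∑ v, ‖z - θ v‖) ∧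
      ∃! g : EuclideanSpace ℝ (Fin d),
        ∀ z, (V : ℝ)⁻¹ * ∑ v, ‖g - θ v‖ ≤ (V : ℝ)⁻¹ * ∑ v, ‖z - θ v‖ := by
  have hV : 0 < V := by
    rcases Nat.eq_zero_or_pos V with h | h
    · subst h
      rw [Set.range_eq_empty, Submodule.span_empty, finrank_bot] at hdim
      omega
    · exact h
  have hVi : (0 : ℝ) < (V : ℝ)⁻¹ := by positivity
  have hsc : StrictConvexOn ℝ Set.univ
        (fun z : EuclideanSpace ℝ (Fin d) => (V : ℝ)⁻¹ * ∑ v, ‖z - θ v‖) := by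
    refine ⟨convex_univ, ?_⟩
    intro x _ y _ hxy a b ha hb hab
    have hdec : ∀ v, a • x + b • y - θ v = a • (x - θ v) + b • (y - θ v) := by
      intro v
      have : θ v = a • θ v + b • θ v := by rw [← add_smul, hab, one_smul]
      rw [smul_sub, smul_sub]
      nth_rewrite 1 [this]
      abel
    have hna : ∀ w : EuclideanSpace ℝ (Fin d), ‖a • w‖ = a * ‖w‖ := fun w => by
      rw [norm_smul, Real.norm_of_nonneg ha.le]
    have hnb : ∀ w : EuclideanSpace ℝ (Fin d), ‖b • w‖ = b * ‖w‖ := fun w => by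
      rw [norm_smul, Real.norm_of_nonneg hb.le]
    have key : ∃ v, ¬ SameRay ℝ (a • (x - θ v)) (b • (y - θ v)) := by
      by_contra! hcon
      have hle : Submodule.span ℝ (Set.range fun p : Fin V × Fin V => θ p.1 - θ p.2)
          ≤ Submodule.span ℝ {x - y} := by
        rw [Submodule.span_le]
        rintro _ ⟨⟨v, w⟩, rfl⟩
        have h1 := mem_span_of_sameRay_aux hxy ha hb (hcon v)
        have h2 := mem_span_of_sameRay_aux hxy ha hb (hcon w)
        have h3 := Submodule.sub_mem _ h2 h1
        simpa using h3
      have h4 := Submodule.finrank_mono hle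
      rw [finrank_span_singleton (sub_ne_zero.mpr hxy)] at h4
      omega
    have hlt : ∑ v, ‖a • x + b • y - θ v‖ < ∑ v, (a * ‖x - θ v‖ + b * ‖y - θ v‖) := by
      apply Finset.sum_lt_sum
      · intro v _
        rw [hdec, ← hna, ← hnb]
        exact norm_add_le _ _
      · obtain ⟨v, hv⟩ := key
        refine ⟨v, Finset.mem_univ _, ?_⟩
        rw [hdec, ← hna, ← hnb]
        exact norm_add_lt_of_not_sameRay hv
    rw [Finset.sum_add_distrib, ← Finset.mul_sum, ← Finset.mul_sum] at hlt
    have := mul_lt_mul_of_pos_left hlt hVi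
    simp only [smul_eq_mul]
    linarith
  refine ⟨hsc, ?_⟩
  have hcont : Continuous
      (fun z : EuclideanSpace ℝ (Fin d) => (V : ℝ)⁻¹ * ∑ v, ‖z - θ v‖) := by fun_prop
  have hlim : Filter.Tendsto
      (fun z : EuclideanSpace ℝ (Fin d) => (V : ℝ)⁻¹ * ∑ v, ‖z - θ v‖)
      (Filter.cocompact _) Filter.atTop := by
    apply Filter.Tendsto.const_mul_atTop hVi
    have h1 : Filter.Tendsto (fun z : EuclideanSpace ℝ (Fin d) => ‖z‖ - ‖θ ⟨0, hV⟩‖)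
        (Filter.cocompact _) Filter.atTop :=
      Filter.tendsto_atTop_add_const_right _ _ (tendsto_norm_cocompact_atTop)
    refine Filter.tendsto_atTop_mono (fun z => ?_) h1
    exact (norm_sub_norm_le _ _).trans
      (Finset.single_le_sum (f := fun v => ‖z - θ v‖) (fun v _ => norm_nonneg _)
        (Finset.mem_univ _))
  obtain ⟨g, hg⟩ := hcont.exists_forall_le hlim
  refine ⟨g, hg, ?_⟩
  intro g' hg'
  exact hsc.eq_of_isMinOn (fun z _ => hg' z) (fun z _ => hg z) (Set.mem_univ _) (Set.mem_univ _)
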